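/- Let n ≥ 3, let k be a field, let S = k[X_0, X_1, …, X_n], let 𝔞 ⊆ S be the ideal generated by the 2×2 minors of the matrix with rows (X_0, …, X_{n−1}) and (X_1, …, X_n), and let A = S/𝔞 with x_i the image of X_i. Let I = (x_0, x_1, x_{n−1}) and Q = (x_0, x_{n−1}). Then I^{n−1} = Q·I^{n−2} and x_1^{n−2} ∉ Q·I^{n−3}; that is, r_Q(I) = n − 2. -/

import Mathlib

set_option synthInstance.maxHeartbeats 1000000

open MvPolynomial

/-- The reduction number `r_Q(I) = inf { m ≥ 0 | I^(m+1) = Q·I^m }`. -/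
noncomputable def redNum {A : Type*} [CommRing A] (Q I : Ideal A) : ℕ∞ :=
  sInf {l : ℕ∞ | ∃ m : ℕ, l = (m : ℕ∞) ∧ I ^ (m + 1) = Q * I ^ m}

theorem Ideal.sup_span_singleton_pow_succ_le {R : Type*} [CommRing R] (J : Ideal R) (a : R)
    (m : ℕ) :
    (J ⊔ Ideal.span {a}) ^ (m + 1) ≤
      J * (J ⊔ Ideal.span {a}) ^ m ⊔ Ideal.span {a ^ (m + 1)} := by
  induction m with
  | zero => simp
  | succ m ih =>
    rw [pow_succ, Ideal.mul_sup]
    refine sup_le (le_sup_of_le_left (mul_comm _ _).le) ?_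
    refine (Ideal.mul_mono_left ih).trans ?_
    rw [Ideal.sup_mul, Ideal.span_singleton_mul_span_singleton, ← pow_succ, mul_assoc]
    refine sup_le_sup_right (Ideal.mul_mono_right ?_) _
    rw [pow_succ _ m]
    exact Ideal.mul_mono_right le_sup_right

theorem Ideal.mul_le_span_pair {R : Type*} [CommRing R] {J K : Ideal R} {u v w : R}
    (hJ : J ≤ Ideal.span {u, v}) (hK : K ≤ Ideal.span {w, v}) :
    J * K ≤ Ideal.span {u * w, v} := by
  refine (Ideal.mul_mono hJ hK).trans ?_
  rw [Ideal.span_pair_mul_span_pair, Ideal.span_le]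
  have hv : v ∈ Ideal.span {u * w, v} := Ideal.subset_span (by simp)
  rintro _ (rfl | rfl | rfl | rfl)
  · exact Ideal.subset_span (by simp)
  · exact Ideal.mul_mem_left _ _ hv
  · exact Ideal.mul_mem_right _ _ hv
  · exact Ideal.mul_mem_left _ _ hv

theorem Ideal.pow_le_span_pair {R : Type*} [CommRing R] {J : Ideal R} {u v : R}
    (hJ : J ≤ Ideal.span {u, v}) (m : ℕ) : J ^ m ≤ Ideal.span {u ^ m, v} := by
  induction m with
  | zero =>
    have : Ideal.span {u ^ 0, v} = ⊤ := Ideal.eq_top_of_isUnit_mem _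
      (Ideal.subset_span (Set.mem_insert _ _)) (by simp)
    exact this ▸ le_top
  | succ m ih =>
    rw [pow_succ, pow_succ]
    exact Ideal.mul_le_span_pair ih hJ

theorem Polynomial.C_mul_X_pow_notMem_span_pair {R : Type*} [CommRing R] {a b : R}
    (h : ¬ b ∣ a) {i j : ℕ} (hij : i < j) :
    Polynomial.C a * Polynomial.X ^ i ∉
      Ideal.span {Polynomial.C b, (Polynomial.X ^ j : Polynomial R)} := by
  rw [Ideal.mem_span_pair]
  rintro ⟨p, q, hpq⟩
  apply h
  have := congrArg (fun f => Polynomial.coeff f i) hpq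
  simp [Polynomial.coeff_mul_X_pow', hij.not_ge] at this
  exact ⟨p.coeff i, by rw [← this, mul_comm]⟩

theorem redNum_eq_of_pow_notMem {A : Type*} [CommRing A] {Q I : Ideal A} {a : A} {m : ℕ}
    (h : I ^ (m + 1) = Q * I ^ m) (ha : a ∈ I)
    (hne : ∀ l, m = l + 1 → a ^ (l + 1) ∉ Q * I ^ l) : redNum Q I = m := by
  refine le_antisymm (sInf_le ⟨m, rfl, h⟩) (le_sInf ?_)
  rintro _ ⟨r, rfl, hr⟩
  by_contra! hlt
  obtain ⟨d, rfl⟩ := Nat.exists_eq_add_of_lt (Nat.cast_lt.mp hlt)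
  refine hne _ rfl ?_
  have : I ^ (r + d + 1) = Q * I ^ (r + d) := by
    rw [add_right_comm, pow_add, hr, mul_assoc, ← pow_add]
  exact this ▸ Ideal.pow_mem_pow ha _

/-- **Example 4.1 (2).**  Let `n ≥ 3`, `S = k[X 0, …, X n]`, `𝔞` the ideal of 2×2
minors of the matrix with rows `(X 0, …, X (n-1))` and `(X 1, …, X n)`, and
`A = S/𝔞` with `x i` the image of `X i`.  For `I = (x 0, x 1, x (n-1))` and
`Q = (x 0, x (n-1))` one has `I^(n-1) = Q·I^(n-2)` and
`x 1 ^ (n-2) ∉ Q·I^(n-3)`; that is, `r_Q(I) = n − 2`. -/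
theorem reduction_number_example_two (n : ℕ) (hn : 3 ≤ n) (k : Type*) [Field k]
    (𝔞 : Ideal (MvPolynomial (Fin (n + 1)) k))
    (h𝔞 : 𝔞 = Ideal.span {f | ∃ (i j : ℕ) (hij : i < j) (hj : j + 1 ≤ n),
      f = X (⟨i, by omega⟩ : Fin (n + 1)) * X (⟨j + 1, by omega⟩ : Fin (n + 1))
        - X (⟨i + 1, by omega⟩ : Fin (n + 1)) * X (⟨j, by omega⟩ : Fin (n + 1))})
    (x : Fin (n + 1) → MvPolynomial (Fin (n + 1)) k ⧸ 𝔞)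
    (hx : ∀ i, x i = Ideal.Quotient.mk 𝔞 (X i))
    (I Q : Ideal (MvPolynomial (Fin (n + 1)) k ⧸ 𝔞))
    (hI : I = Ideal.span {x ⟨0, by omega⟩, x ⟨1, by omega⟩, x ⟨n - 1, by omega⟩})
    (hQ : Q = Ideal.span {x ⟨0, by omega⟩, x ⟨n - 1, by omega⟩}) :
    I ^ (n - 1) = Q * I ^ (n - 2) ∧ x ⟨1, by omega⟩ ^ (n - 2) ∉ Q * I ^ (n - 3) ∧
      redNum Q I = ((n - 2 : ℕ) : ℕ∞) := by
  have hrel : ∀ j (_ : 0 < j) (hj : j + 1 ≤ n),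
      x ⟨1, by omega⟩ * x ⟨j, by omega⟩ = x ⟨0, by omega⟩ * x ⟨j + 1, by omega⟩ := by
    intro j hj0 hj
    simp only [hx, ← map_mul]
    refine (Ideal.Quotient.eq.mpr ?_).symm
    rw [h𝔞]
    exact Ideal.subset_span ⟨0, j, hj0, hj, rfl⟩
  have hpow : ∀ j (hj : j + 1 ≤ n), x ⟨1, by omega⟩ ^ (j + 1) =
      x ⟨0, by omega⟩ ^ j * x ⟨j + 1, by omega⟩ := by
    intro j
    induction j with
    | zero => intro _; simp
    | succ j ih =>
      intro hj
      rw [pow_succ, ih (by omega), mul_assoc, mul_comm (x ⟨j + 1, _⟩),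
        hrel (j + 1) (by omega) hj, pow_succ, mul_assoc]
  have hQI : Q ≤ I := by
    rw [hQ, hI]
    exact Ideal.span_mono (by rintro _ (rfl | rfl) <;> simp)
  have hsup : I = Q ⊔ Ideal.span {x ⟨1, by omega⟩} := by
    rw [hQ, hI, ← Ideal.span_union]
    congr 1
    ext
    simp only [Set.mem_insert_iff, Set.mem_singleton_iff, Set.mem_union]
    tauto
  have h0Q : x ⟨0, by omega⟩ ∈ Q := hQ ▸ Ideal.subset_span (by simp)
  have hlQ : x ⟨n - 1, by omega⟩ ∈ Q := hQ ▸ Ideal.subset_span (by simp)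
  have h1I : x ⟨1, by omega⟩ ∈ I := hI ▸ Ideal.subset_span (by simp)
  have hred : I ^ (n - 2 + 1) = Q * I ^ (n - 2) := by
    refine le_antisymm ?_ ((Ideal.mul_mono_left hQI).trans (pow_succ' I (n - 2)).ge)
    have hle := Ideal.sup_span_singleton_pow_succ_le Q (x ⟨1, by omega⟩) (n - 2)
    rw [← hsup] at hle
    refine hle.trans (sup_le le_rfl ?_)
    rw [Ideal.span_singleton_le_iff_mem, hpow (n - 2) (by omega), mul_comm]
    have hidx : (⟨n - 2 + 1, by omega⟩ : Fin (n + 1)) = ⟨n - 1, by omega⟩ :=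
      Fin.ext (by simp only; omega)
    rw [hidx]
    exact Ideal.mul_mem_mul hlQ (Ideal.pow_mem_pow (hQI h0Q) _)
  have hnot : x ⟨1, by omega⟩ ^ (n - 2) ∉ Q * I ^ (n - 3) := by
    let s : Polynomial (Polynomial k) := Polynomial.C Polynomial.X
    let t : Polynomial (Polynomial k) := Polynomial.X
    let ψ : MvPolynomial (Fin (n + 1)) k →ₐ[k] Polynomial (Polynomial k) :=
      MvPolynomial.aeval fun i => s ^ (n - (i : ℕ)) * t ^ (i : ℕ)
    have hψ : ∀ f ∈ 𝔞, ψ f = 0 := by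
      suffices 𝔞 ≤ RingHom.ker ψ from fun f hf => this hf
      rw [h𝔞, Ideal.span_le]
      rintro _ ⟨i, j, hij, hj, rfl⟩
      obtain ⟨d, rfl⟩ := Nat.exists_eq_add_of_le hj
      simp only [SetLike.mem_coe, RingHom.mem_ker, map_sub, map_mul, ψ, MvPolynomial.aeval_X]
      rw [show j + 1 + d - i = (j + 1 + d - (i + 1)) + 1 by omega,
        show j + 1 + d - j = (j + 1 + d - (j + 1)) + 1 by omega]
      ring
    let φ := Ideal.Quotient.lift 𝔞 ψ.toRingHom hψ
    have hφ : ∀ i, φ (x i) = s ^ (n - (i : ℕ)) * t ^ (i : ℕ) := fun i => by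
      simp [φ, ψ, hx]
    have hmapQ : Q.map φ ≤ Ideal.span {s ^ n, t ^ (n - 1)} := by
      rw [hQ, Ideal.map_span, Ideal.span_le]
      rintro _ ⟨_, rfl | rfl, rfl⟩
      · rw [hφ]
        exact Ideal.subset_span (by simp)
      · rw [hφ]
        exact Ideal.mul_mem_left _ _ (Ideal.subset_span (by simp))
    have hmapI : I.map φ ≤ Ideal.span {s ^ (n - 1), t ^ (n - 1)} := by
      rw [hI, Ideal.map_span, Ideal.span_le]
      have hs : s ^ (n - 1) ∈ Ideal.span {s ^ (n - 1), t ^ (n - 1)} :=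
        Ideal.subset_span (by simp)
      rintro _ ⟨_, rfl | rfl | rfl, rfl⟩
      · rw [hφ]
        exact Ideal.mul_mem_right _ _ (Ideal.mem_of_dvd _ (pow_dvd_pow s (by simp)) hs)
      · rw [hφ]
        exact Ideal.mul_mem_right _ _ hs
      · rw [hφ]
        exact Ideal.mul_mem_left _ _ (Ideal.subset_span (by simp))
    intro hmem
    have hmem' := Ideal.mem_map_of_mem φ hmem
    rw [Ideal.map_mul, Ideal.map_pow, map_pow, hφ] at hmem'
    replace hmem' := Ideal.mul_le_span_pair hmapQ (Ideal.pow_le_span_pair hmapI _) hmem'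
    refine Polynomial.C_mul_X_pow_notMem_span_pair (R := Polynomial k)
      (a := Polynomial.X ^ ((n - 1) * (n - 2))) (b := Polynomial.X ^ (n + (n - 1) * (n - 3)))
      (i := n - 2) (j := n - 1) ?_ (by omega) ?_
    · rw [pow_dvd_pow_iff Polynomial.X_ne_zero Polynomial.not_isUnit_X, not_le]
      obtain ⟨p, rfl⟩ := Nat.exists_eq_add_of_le' hn
      simp only [Nat.add_sub_cancel, show p + 3 - 1 = p + 2 by omega,
        show p + 3 - 2 = p + 1 by omega]
      nlinarith
    · simpa [s, t, mul_pow, ← pow_mul, ← pow_add] using hmem'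
  refine ⟨?_, hnot, redNum_eq_of_pow_notMem hred h1I fun l hl => ?_⟩
  · rw [← hred]
    congr 1
    omega
  · rwa [← hl, show l = n - 3 by omega]
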